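/- Let a > 0 and c < 0. Then the function z ↦ (Ψ(a,c,z))² / Ψ(2a,c,z) is NOT completely monotone on (0,∞): there exist a natural number n and z > 0 such that (−1)^n times the n-th derivative at z of this function is strictly negative. -/

import Mathlib

open MeasureTheory Set

/-- The confluent hypergeometric function of the second kind (Tricomi's integral). -/
noncomputable def Psi (a c z : ℝ) : ℝ :=
  (1 / Real.Gamma a) * ∫ t in Ioi (0 : ℝ), Real.exp (-z * t) * t ^ (a - 1) * (1 + t) ^ (c - a - 1)

open Filter Topology

namespace Tricomi

/-- The integrand of the `k`-th moment of Tricomi's integral. -/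
noncomputable def kernel (a c k z t : ℝ) : ℝ :=
  Real.exp (-z * t) * t ^ (a - 1 + k) * (1 + t) ^ (c - a - 1)

/-- The `k`-th moment of Tricomi's integral. -/
noncomputable def moment (a c k z : ℝ) : ℝ :=
  ∫ t in Ioi (0 : ℝ), kernel a c k z t

theorem Psi_eq_moment (a c z : ℝ) : Psi a c z = (1 / Real.Gamma a) * moment a c 0 z := by
  simp [Psi, moment, kernel]

theorem kernel_pos (a c k z : ℝ) {t : ℝ} (ht : 0 < t) : 0 < kernel a c k z t := by
  unfold kernel
  positivity

theorem continuousOn_kernel (a c k z : ℝ) : ContinuousOn (kernel a c k z) (Ioi 0) := by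
  intro t ht
  have ht : 0 < t := ht
  apply ContinuousAt.continuousWithinAt
  unfold kernel
  refine ContinuousAt.mul (ContinuousAt.mul (by fun_prop) ?_) ?_
  · exact Real.continuousAt_rpow_const _ _ (Or.inl ht.ne')
  · exact ContinuousAt.rpow_const (by fun_prop) (Or.inl (by positivity))

theorem aestronglyMeasurable_kernel (a c k z : ℝ) :
    AEStronglyMeasurable (kernel a c k z) (volume.restrict (Ioi 0)) :=
  (continuousOn_kernel a c k z).aestronglyMeasurable measurableSet_Ioi

theorem integrableOn_kernel {a c k z : ℝ} (hz : 0 < z) (hk : 0 < a + k) (hc : c ≤ a + 1) :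
    IntegrableOn (kernel a c k z) (Ioi 0) := by
  have h := integrableOn_rpow_mul_exp_neg_mul_rpow (p := 1) (s := a - 1 + k) (b := z)
    (by linarith) one_pos hz
  refine Integrable.mono' h (aestronglyMeasurable_kernel a c k z) ?_
  filter_upwards [ae_restrict_mem measurableSet_Ioi] with t ht
  have ht : 0 < t := ht
  rw [Real.norm_of_nonneg (kernel_pos a c k z ht).le, kernel, Real.rpow_one]
  have h1 : (1 + t) ^ (c - a - 1) ≤ 1 :=
    Real.rpow_le_one_of_one_le_of_nonpos (by linarith) (by linarith)
  calc _ ≤ Real.exp (-z * t) * t ^ (a - 1 + k) * 1 := by gcongr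
    _ = _ := by ring

theorem integrableOn_kernel_zero {a c k : ℝ} (hk : 0 < a + k) (hck : c + k < 1) :
    IntegrableOn (kernel a c k 0) (Ioi 0) := by
  rw [← Ioc_union_Ioi_eq_Ioi zero_le_one, integrableOn_union]
  constructor
  · have h : IntegrableOn (fun t : ℝ => t ^ (a - 1 + k)) (Ioc 0 1) :=
      (intervalIntegral.intervalIntegrable_rpow' (by linarith)).1
    refine Integrable.mono' h
      ((aestronglyMeasurable_kernel a c k 0).mono_set Ioc_subset_Ioi_self) ?_
    filter_upwards [ae_restrict_mem measurableSet_Ioc] with t ht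
    rw [Real.norm_of_nonneg (kernel_pos a c k 0 ht.1).le, kernel]
    have h1 : (1 + t) ^ (c - a - 1) ≤ 1 :=
      Real.rpow_le_one_of_one_le_of_nonpos (by linarith [ht.1]) (by linarith)
    have h2 : 0 ≤ t ^ (a - 1 + k) := Real.rpow_nonneg ht.1.le _
    simpa using mul_le_mul_of_nonneg_left h1 h2
  · have h : IntegrableOn (fun t : ℝ => t ^ ((a - 1 + k) + (c - a - 1))) (Ioi 1) :=
      integrableOn_Ioi_rpow_of_lt (by linarith) one_pos
    refine Integrable.mono' h
      ((aestronglyMeasurable_kernel a c k 0).mono_set (Ioi_subset_Ioi zero_le_one)) ?_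
    filter_upwards [ae_restrict_mem measurableSet_Ioi] with t ht
    have ht0 : 0 < t := lt_trans one_pos ht
    rw [Real.norm_of_nonneg (kernel_pos a c k 0 ht0).le, kernel, Real.rpow_add ht0 (a - 1 + k) (c - a - 1)]
    have h1 : (1 + t) ^ (c - a - 1) ≤ t ^ (c - a - 1) :=
      Real.rpow_le_rpow_of_nonpos ht0 (by linarith) (by linarith)
    have h2 : 0 ≤ t ^ (a - 1 + k) := Real.rpow_nonneg ht0.le _
    simpa using mul_le_mul_of_nonneg_left h1 h2

theorem moment_pos {a c k z : ℝ} (h : IntegrableOn (kernel a c k z) (Ioi 0)) :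
    0 < moment a c k z := by
  unfold moment
  rw [setIntegral_pos_iff_support_of_nonneg_ae _ h]
  · have : Function.support (kernel a c k z) ∩ Ioi 0 = Ioi 0 :=
      inter_eq_right.2 fun t ht => (kernel_pos a c k z ht).ne'
    simp [this]
  · filter_upwards [ae_restrict_mem measurableSet_Ioi] with t ht
    exact (kernel_pos a c k z ht).le

theorem kernel_add_one {a c k z t : ℝ} (ht : 0 < t) :
    kernel a c (k + 1) z t = t * kernel a c k z t := by
  rw [kernel, kernel, ← add_assoc, Real.rpow_add_one ht.ne']
  ring

theorem kernel_anti {a c k z w t : ℝ} (ht : 0 < t) (h : z ≤ w) :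
    kernel a c k w t ≤ kernel a c k z t := by
  unfold kernel
  have : -w * t ≤ -z * t := by nlinarith
  gcongr

theorem hasDerivAt_moment {a c k z : ℝ} (hz : 0 < z) (hk : 0 < a + k) (hc : c ≤ a + 1) :
    HasDerivAt (moment a c k) (-moment a c (k + 1) z) z := by
  have hmem : Ioi (z / 2) ∈ 𝓝 z := Ioi_mem_nhds (by linarith)
  have key := hasDerivAt_integral_of_dominated_loc_of_deriv_le
    (μ := volume.restrict (Ioi (0 : ℝ))) (F := fun w t => kernel a c k w t)
    (F' := fun w t => -kernel a c (k + 1) w t) (bound := kernel a c (k + 1) (z / 2))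
    (x₀ := z) hmem (Eventually.of_forall fun w => aestronglyMeasurable_kernel a c k w)
    (integrableOn_kernel hz hk hc) (aestronglyMeasurable_kernel a c (k + 1) z).neg
    (by
      filter_upwards [ae_restrict_mem measurableSet_Ioi] with t ht w hw
      rw [norm_neg, Real.norm_of_nonneg (kernel_pos _ _ _ _ ht).le]
      exact kernel_anti ht (le_of_lt hw))
    (integrableOn_kernel (by linarith) (by linarith) hc)
    (by
      filter_upwards [ae_restrict_mem measurableSet_Ioi] with t ht w _
      rw [kernel_add_one ht]
      have h1 : HasDerivAt (fun w : ℝ => -w * t) (-1 * t) w :=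
        ((hasDerivAt_id w).neg).mul_const t
      have h2 := (h1.exp.mul_const (t ^ (a - 1 + k))).mul_const ((1 + t) ^ (c - a - 1))
      refine h2.congr_deriv ?_
      rw [kernel]
      ring)
  refine key.2.congr_deriv ?_
  rw [integral_neg, moment]

theorem tendsto_moment_zero {a c k : ℝ} (h : IntegrableOn (kernel a c k 0) (Ioi 0)) :
    Tendsto (moment a c k) (𝓝[>] 0) (𝓝 (moment a c k 0)) := by
  refine tendsto_integral_filter_of_dominated_convergence (kernel a c k 0)
    (Eventually.of_forall fun w => aestronglyMeasurable_kernel a c k w) ?_ h ?_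
  · filter_upwards [self_mem_nhdsWithin] with w hw
    filter_upwards [ae_restrict_mem measurableSet_Ioi] with t ht
    rw [Real.norm_of_nonneg (kernel_pos _ _ _ _ ht).le]
    exact kernel_anti ht (le_of_lt hw)
  · refine Eventually.of_forall fun t => ?_
    have : Continuous fun w => kernel a c k w t := by
      unfold kernel
      fun_prop
    exact (this.tendsto 0).mono_left nhdsWithin_le_nhds

/-- Kummer's differential equation, as a relation between the moments. -/
theorem kummer_moment {a c z : ℝ} (ha : 0 < a) (hc : c < 0) (hz : 0 ≤ z)
    (h0 : IntegrableOn (kernel a c 0 z) (Ioi 0)) (h1 : IntegrableOn (kernel a c 1 z) (Ioi 0))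
    (h2 : IntegrableOn (fun t => z * kernel a c 2 z t) (Ioi 0)) :
    a * moment a c 0 z + (c - z) * moment a c 1 z - z * moment a c 2 z = 0 := by
  set F : ℝ → ℝ := fun t => Real.exp (-z * t) * t ^ a * (1 + t) ^ (c - a) with hF
  have h01 : IntegrableOn (fun t => a * kernel a c 0 z t + (c - z) * kernel a c 1 z t) (Ioi 0) :=
    (h0.const_mul a).add (h1.const_mul (c - z))
  have hI : IntegrableOn (fun t => a * kernel a c 0 z t + (c - z) * kernel a c 1 z t
      - z * kernel a c 2 z t) (Ioi 0) :=
    h01.sub h2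
  have hcont : ContinuousWithinAt F (Ici 0) 0 := by
    apply ContinuousAt.continuousWithinAt
    refine ContinuousAt.mul (ContinuousAt.mul (by fun_prop) ?_) ?_
    · exact Real.continuousAt_rpow_const _ _ (Or.inr ha.le)
    · exact ContinuousAt.rpow_const (by fun_prop) (Or.inl (by norm_num))
  have hderiv : ∀ t ∈ Ioi (0 : ℝ), HasDerivAt F (a * kernel a c 0 z t
      + (c - z) * kernel a c 1 z t - z * kernel a c 2 z t) t := by
    intro t ht
    have ht : 0 < t := ht
    have e1 : HasDerivAt (fun t : ℝ => -z * t) (-z * 1) t := (hasDerivAt_id t).const_mul (-z)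
    have e2 := Real.hasDerivAt_rpow_const (x := t) (p := a) (Or.inl ht.ne')
    have e3 := ((hasDerivAt_id t).const_add 1).rpow_const (p := c - a)
      (Or.inl (by simp only [id]; positivity))
    refine ((e1.exp.mul e2).mul e3).congr_deriv ?_
    have k1 : kernel a c 1 z t = t * kernel a c 0 z t := by
      simpa using kernel_add_one (a := a) (c := c) (k := 0) (z := z) ht
    have k2 : kernel a c 2 z t = t * (t * kernel a c 0 z t) := by
      rw [← k1, ← kernel_add_one ht]
      norm_num
    have p1 : t ^ a = t ^ (a - 1) * t := by
      rw [← Real.rpow_add_one ht.ne']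
      ring_nf
    have p2 : (1 + t) ^ (c - a) = (1 + t) ^ (c - a - 1) * (1 + t) := by
      rw [← Real.rpow_add_one (by positivity)]
      ring_nf
    rw [k1, k2]
    simp only [kernel, id, add_zero, p1, p2, Pi.mul_apply]
    ring
  have hlim : Tendsto F atTop (𝓝 0) := by
    have hb : Tendsto (fun t : ℝ => (1 + t) ^ c) atTop (𝓝 0) := by
      have := (tendsto_rpow_neg_atTop (y := -c) (by linarith)).comp
        (tendsto_atTop_add_const_left atTop (1 : ℝ) tendsto_id)
      simpa [Function.comp_def] using this
    refine squeeze_zero' ?_ ?_ hb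
    · filter_upwards [eventually_gt_atTop 0] with t ht
      simp only [hF]
      positivity
    · filter_upwards [eventually_gt_atTop 0] with t ht
      have q1 : Real.exp (-z * t) ≤ 1 := Real.exp_le_one_iff.2 (by nlinarith)
      have q2 : t ^ a ≤ (1 + t) ^ a := Real.rpow_le_rpow ht.le (by linarith) ha.le
      calc F t ≤ 1 * (1 + t) ^ a * (1 + t) ^ (c - a) := by
            simp only [hF]
            gcongr
        _ = (1 + t) ^ c := by
            rw [one_mul, ← Real.rpow_add (by positivity)]
            ring_nf
  have key := integral_Ioi_of_hasDerivAt_of_tendsto hcont hderiv hI hlim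
  have hF0 : F 0 = 0 := by simp [hF, Real.zero_rpow ha.ne']
  rw [integral_sub h01 h2,
    integral_add (h0.const_mul a) (h1.const_mul (c - z)), integral_const_mul, integral_const_mul,
    integral_const_mul, hF0, sub_zero] at key
  exact key

theorem kummer_moment_of_pos {a c z : ℝ} (ha : 0 < a) (hc : c < 0) (hz : 0 < z) :
    a * moment a c 0 z + (c - z) * moment a c 1 z - z * moment a c 2 z = 0 :=
  kummer_moment ha hc hz.le (integrableOn_kernel hz (by linarith) (by linarith))
    (integrableOn_kernel hz (by linarith) (by linarith))
    ((integrableOn_kernel hz (by linarith) (by linarith)).const_mul z)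

theorem kummer_moment_zero {a c : ℝ} (ha : 0 < a) (hc : c < 0) :
    a * moment a c 0 0 + c * moment a c 1 0 = 0 := by
  have := kummer_moment (z := 0) ha hc le_rfl
    (integrableOn_kernel_zero (by linarith) (by linarith))
    (integrableOn_kernel_zero (by linarith) (by linarith)) (by simp)
  linarith

end Tricomi

open Tricomi

/-- Corollary: for `a > 0` and `c < 0`, the function `z ↦ Ψ(a,c,z)²/Ψ(2a,c,z)` is
NOT completely monotone on `(0,∞)`. -/
theorem Psi_sq_ratio_not_CM (a c : ℝ) (ha : 0 < a) (hc : c < 0) :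
    ∃ (n : ℕ) (z : ℝ), 0 < z ∧
      (-1 : ℝ) ^ n * iteratedDeriv n (fun w => (Psi a c w) ^ 2 / Psi (2 * a) c w) z < 0 := by
  by_contra! hCM
  have hb : 0 < 2 * a := by positivity
  set f : ℝ → ℝ := fun w => (Psi a c w) ^ 2 / Psi (2 * a) c w with hf
  set C : ℝ := Real.Gamma (2 * a) / Real.Gamma a ^ 2 with hC
  have hCpos : 0 < C := div_pos (Real.Gamma_pos_of_pos hb) (pow_pos (Real.Gamma_pos_of_pos ha) 2)
  have hfC : f = fun w => C * (moment a c 0 w ^ 2 / moment (2 * a) c 0 w) := by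
    funext w
    have h1 := (Real.Gamma_pos_of_pos ha).ne'
    have h2 := (Real.Gamma_pos_of_pos hb).ne'
    simp only [hf, hC, Psi_eq_moment]
    field_simp
  have hpos : ∀ b k z : ℝ, 0 < b → 0 ≤ k → 0 < z → 0 < moment b c k z := fun b k z h h' hz =>
    moment_pos (integrableOn_kernel hz (by linarith) (by linarith))
  have hd0 : ∀ b z : ℝ, 0 < b → 0 < z →
      HasDerivAt (moment b c 0) (-moment b c 1 z) z := fun b z h hz => by
    simpa using hasDerivAt_moment (k := 0) (c := c) hz (by linarith : 0 < b + 0) (by linarith)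
  have hd1 : ∀ b z : ℝ, 0 < b → 0 < z →
      HasDerivAt (moment b c 1) (-moment b c 2 z) z := fun b z h hz => by
    have := hasDerivAt_moment (k := 1) (c := c) hz (by linarith : 0 < b + 1) (by linarith)
    norm_num at this
    exact this
  -- `G` has the sign of the logarithmic derivative of `f`.
  set G : ℝ → ℝ := fun z => moment a c 0 z * moment (2 * a) c 1 z
    - 2 * moment a c 1 z * moment (2 * a) c 0 z with hG
  have hGd : ∀ z, 0 < z → HasDerivAt G (-moment a c 1 z * moment (2 * a) c 1 z
      + moment a c 0 z * (-moment (2 * a) c 2 z)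
      - (2 * (-moment a c 2 z) * moment (2 * a) c 0 z
        + 2 * moment a c 1 z * (-moment (2 * a) c 1 z))) z := fun z hz =>
    ((hd0 a z ha hz).mul (hd1 _ z hb hz)).sub
      (((hd1 a z ha hz).const_mul 2).mul (hd0 _ z hb hz))
  set D : ℝ → ℝ := fun z => C * (moment a c 0 z * G z / moment (2 * a) c 0 z ^ 2) with hD
  have hfd : ∀ z, 0 < z → HasDerivAt f (D z) z := by
    intro z hz
    rw [hfC]
    have hv := (hpos _ 0 z hb le_rfl hz).ne'
    refine ((((hd0 a z ha hz).pow 2).div (hd0 _ z hb hz) hv).const_mul C).congr_deriv ?_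
    simp only [hD, hG]
    congr 2
    simp only [Pi.pow_apply]
    push_cast
    ring
  have hDd : ∀ z, 0 < z → DifferentiableAt ℝ D z := by
    intro z hz
    have hv := (pow_pos (hpos _ 0 z hb le_rfl hz) 2).ne'
    exact ((((hd0 a z ha hz).mul (hGd z hz)).div ((hd0 _ z hb hz).pow 2)
      hv).const_mul C).differentiableAt
  have hDnonpos : ∀ z, 0 < z → D z ≤ 0 := by
    intro z hz
    have := hCM 1 z hz
    rw [iteratedDeriv_one, (hfd z hz).deriv] at this
    linarith
  have hDmono : MonotoneOn D (Ioi 0) := by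
    refine monotoneOn_of_deriv_nonneg (convex_Ioi 0)
      (fun z hz => (hDd z hz).continuousAt.continuousWithinAt)
      (fun z hz => (hDd z (by simpa using hz)).differentiableWithinAt) ?_
    intro z hz
    have hz : 0 < z := by simpa using hz
    have h := hCM 2 z hz
    have heq : deriv f =ᶠ[𝓝 z] D := by
      filter_upwards [Ioi_mem_nhds hz] with w hw using (hfd w hw).deriv
    rw [iteratedDeriv_succ, iteratedDeriv_one, heq.deriv_eq] at h
    simpa using h
  have hDlim : Tendsto D (𝓝[>] 0) (𝓝 0) := by
    have hI0 : ∀ b : ℝ, 0 < b → IntegrableOn (kernel b c 0 0) (Ioi 0) := fun b h =>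
      integrableOn_kernel_zero (by linarith) (by linarith)
    have hI1 : ∀ b : ℝ, 0 < b → IntegrableOn (kernel b c 1 0) (Ioi 0) := fun b h =>
      integrableOn_kernel_zero (by linarith) (by linarith)
    have hG0 : G 0 = 0 := by
      have h1 := kummer_moment_zero ha hc
      have h2 := kummer_moment_zero hb hc
      refine (mul_eq_zero.1 (?_ : c * G 0 = 0)).resolve_left hc.ne
      simp only [hG]
      linear_combination moment a c 0 0 * h2 - 2 * moment (2 * a) c 0 0 * h1
    have hGlim : Tendsto G (𝓝[>] 0) (𝓝 (G 0)) :=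
      ((tendsto_moment_zero (hI0 a ha)).mul (tendsto_moment_zero (hI1 _ hb))).sub
        (((tendsto_moment_zero (hI1 a ha)).const_mul 2).mul (tendsto_moment_zero (hI0 _ hb)))
    have hv := (pow_pos (moment_pos (hI0 _ hb)) 2).ne'
    have := (((tendsto_moment_zero (hI0 a ha)).mul hGlim).div
      ((tendsto_moment_zero (hI0 _ hb)).pow 2) hv).const_mul C
    simpa [hG0] using this
  have hGzero : ∀ z, 0 < z → G z = 0 := by
    intro z hz
    have hDz : D z = 0 := by
      refine le_antisymm (hDnonpos z hz) (le_of_tendsto hDlim ?_)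
      filter_upwards [Ioo_mem_nhdsGT hz] with w hw
      exact hDmono hw.1 hz hw.2.le
    have hu := (hpos a 0 z ha le_rfl hz).ne'
    have hv := (hpos _ 0 z hb le_rfl hz).ne'
    simpa [hD, hCpos.ne', hu, hv] using hDz
  have hG' : deriv G 1 = 0 := by
    have heq : G =ᶠ[𝓝 1] fun _ => 0 := by
      filter_upwards [Ioi_mem_nhds one_pos] with w hw using hGzero w hw
    rw [heq.deriv_eq, deriv_const]
  rw [(hGd 1 one_pos).deriv] at hG'
  have hG1 := hGzero 1 one_pos
  simp only [hG] at hG1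
  have k1 := kummer_moment_of_pos ha hc one_pos
  have k2 := kummer_moment_of_pos hb hc one_pos
  have hprod : moment a c 1 1 * moment (2 * a) c 1 1 = 0 := by
    linear_combination hG' + (c - 1) * hG1 + 2 * moment (2 * a) c 0 1 * k1 - moment a c 0 1 * k2
  exact (mul_pos (hpos a 1 1 ha zero_le_one one_pos) (hpos _ 1 1 hb zero_le_one one_pos)).ne' hprod
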